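/- Let Σ be a binding signature, σ : 𝔸 → NomTrm a substitution of nameful terms for atoms, and M : NomTrm a nameful term. Then the translation sends capture-avoiding substitution of nameful terms to substitution of well-scoped locally nameless terms: ⟦σ * M⟧ = ⟦σ⟧ * ⟦M⟧, where ⟦σ⟧ : 𝔸 → Trm is the composition of σ with the translation ⟦_⟧. In particular, for single substitutions, ⟦(x := M) * N⟧ = (x := ⟦M⟧) * ⟦N⟧. -/

import Mathlib

/- A Plotkin-style binding signature: operators with arities. -/
structure Sig where
  Op : Type
  ar : Op → List ℕ

/- Well-scoped locally nameless terms and argument lists over a signature.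
Atoms are natural numbers. -/
mutual
inductive Trm (S : Sig) : ℕ → Type where
  | idx : {n : ℕ} → Fin n → Trm S n
  | atm : {n : ℕ} → ℕ → Trm S n
  | op  : {n : ℕ} → (o : S.Op) → Args S n (S.ar o) → Trm S n
inductive Args (S : Sig) : ℕ → List ℕ → Type where
  | nil : {n : ℕ} → Args S n []
  | cons : {n m : ℕ} → {ms : List ℕ} → Trm S (m + n) → Args S n ms → Args S n (m :: ms)
end

variable {S : Sig}

/- Scope weakening. -/
mutual
def Trm.weaken : {m n : ℕ} → m ≤ n → Trm S m → Trm S n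
  | _, _, h, .idx i => .idx (Fin.castLE h i)
  | _, _, _, .atm x => .atm x
  | _, _, h, .op o as => .op o (Args.weaken h as)
def Args.weaken : {m n : ℕ} → {ms : List ℕ} → m ≤ n → Args S m ms → Args S n ms
  | _, _, _, _, .nil => .nil
  | _, _, _, h, .cons t ts => .cons (Trm.weaken (Nat.add_le_add_left h _) t) (Args.weaken h ts)
end

/- Support: the finite set of atoms occurring in a term. -/
mutual
def Trm.supp : {n : ℕ} → Trm S n → Finset ℕ
  | _, .idx _ => ∅
  | _, .atm x => {x}
  | _, .op _ as => Args.supp as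
def Args.supp : {n : ℕ} → {ms : List ℕ} → Args S n ms → Finset ℕ
  | _, _, .nil => ∅
  | _, _, .cons t ts => Trm.supp t ∪ Args.supp ts
end

/- Action of a substitution σ : 𝔸 → Trm on terms. -/
mutual
def Trm.subst (σ : ℕ → Trm S 0) : {n : ℕ} → Trm S n → Trm S n
  | _, .idx i => .idx i
  | n, .atm x => Trm.weaken (Nat.zero_le n) (σ x)
  | _, .op o as => .op o (Args.subst σ as)
def Args.subst (σ : ℕ → Trm S 0) : {n : ℕ} → {ms : List ℕ} → Args S n ms → Args S n ms
  | _, _, .nil => .nil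
  | _, _, .cons t ts => .cons (Trm.subst σ t) (Args.subst σ ts)
end

/- The single substitution (x := u). -/
def single (x : ℕ) (u : Trm S 0) : ℕ → Trm S 0 := fun y => if x = y then u else .atm y

/- Renaming a term along ρ : 𝔸 → 𝔸, i.e. substitution along 𝐚 ∘ ρ. -/
def Trm.rename (ρ : ℕ → ℕ) {n : ℕ} (t : Trm S n) : Trm S n :=
  Trm.subst (fun z => .atm (ρ z)) t

/- Opening (i ↝ u)t : replace index i by the 0-term u. -/
mutual
def Trm.opn : {n : ℕ} → Fin (n+1) → Trm S 0 → Trm S (n+1) → Trm S n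
  | n, i, u, .idx j =>
      match finSuccEquiv' i j with
      | none => Trm.weaken (Nat.zero_le n) u
      | some k => .idx k
  | _, _, _, .atm x => .atm x
  | _, i, u, .op o as => .op o (Args.opn i u as)
def Args.opn : {n : ℕ} → {ms : List ℕ} → Fin (n+1) → Trm S 0 → Args S (n+1) ms → Args S n ms
  | _, _, _, _, .nil => .nil
  | _, _, i, u, .cons (m := k) t ts => .cons (Trm.opn (Fin.natAdd k i) u t) (Args.opn i u ts)
end

/- Concretion t[u] of a (1+n)-term at a 0-term. -/
def Trm.conc {n : ℕ} (t : Trm S (n+1)) (u : Trm S 0) : Trm S n := Trm.opn 0 u t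

/- Closing (i ↜ x)t : replace the atom x by the index i. -/
mutual
def Trm.cls : {n : ℕ} → Fin (n+1) → ℕ → Trm S n → Trm S (n+1)
  | _, i, _, .idx j => .idx (i.succAbove j)
  | _, i, x, .atm y => if x = y then .idx i else .atm y
  | _, i, x, .op o as => .op o (Args.cls i x as)
def Args.cls : {n : ℕ} → {ms : List ℕ} → Fin (n+1) → ℕ → Args S n ms → Args S (n+1) ms
  | _, _, _, _, .nil => .nil
  | _, _, i, x, .cons (m := k) t ts => .cons (Trm.cls (Fin.natAdd k i) x t) (Args.cls i x ts)
end

/- Abstraction ⟨x⟩t. -/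
def Trm.abs (x : ℕ) {n : ℕ} (t : Trm S n) : Trm S (n+1) := Trm.cls 0 x t

/- Size of a term. -/
mutual
def Trm.size : {n : ℕ} → Trm S n → ℕ
  | _, .idx _ => 0
  | _, .atm _ => 0
  | _, .op _ as => 1 + Args.size as
def Args.size : {n : ℕ} → {ms : List ℕ} → Args S n ms → ℕ
  | _, _, .nil => 0
  | _, _, .cons t ts => max (Trm.size t) (Args.size ts)
end

/- Nameful terms, argument lists and n-ary bindings over a signature. -/
mutual
inductive NomTrm (S : Sig) : Type where
  | atm : ℕ → NomTrm S
  | op : (o : S.Op) → NomArg S (S.ar o) → NomTrm S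
inductive NomArg (S : Sig) : List ℕ → Type where
  | nil : NomArg S []
  | cons : {m : ℕ} → {ms : List ℕ} → NomBind S m → NomArg S ms → NomArg S (m :: ms)
inductive NomBind (S : Sig) : ℕ → Type where
  | body : NomTrm S → NomBind S 0
  | bind : {m : ℕ} → ℕ → NomBind S m → NomBind S (m+1)
end

/- Support of a nameful term: all atoms occurring, in atom or binding position. -/
mutual
def NomTrm.nsupp : NomTrm S → Finset ℕ
  | .atm x => {x}
  | .op _ bs => NomArg.nsupp bs
def NomArg.nsupp : {ms : List ℕ} → NomArg S ms → Finset ℕ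
  | _, .nil => ∅
  | _, .cons b bs => NomBind.nsupp b ∪ NomArg.nsupp bs
def NomBind.nsupp : {m : ℕ} → NomBind S m → Finset ℕ
  | _, .body M => NomTrm.nsupp M
  | _, .bind x b => insert x (NomBind.nsupp b)
end

/- Renaming of nameful terms: apply ρ to every atom occurrence, including
binding positions. -/
mutual
def NomTrm.rename (ρ : ℕ → ℕ) : NomTrm S → NomTrm S
  | .atm x => .atm (ρ x)
  | .op o bs => .op o (NomArg.rename ρ bs)
def NomArg.rename (ρ : ℕ → ℕ) : {ms : List ℕ} → NomArg S ms → NomArg S ms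
  | _, .nil => .nil
  | _, .cons b bs => .cons (NomBind.rename ρ b) (NomArg.rename ρ bs)
def NomBind.rename (ρ : ℕ → ℕ) : {m : ℕ} → NomBind S m → NomBind S m
  | _, .body M => .body (NomTrm.rename ρ M)
  | _, .bind x b => .bind (ρ x) (NomBind.rename ρ b)
end

/- The single renaming function sending x to y and fixing all other atoms. -/
def rn1 (x y : ℕ) : ℕ → ℕ := fun z => if x = z then y else z

/- α-equivalence of nameful terms. -/
mutual
inductive AEq {S : Sig} : NomTrm S → NomTrm S → Prop where
  | atm (x : ℕ) : AEq (.atm x) (.atm x)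
  | op {o : S.Op} {bs bs' : NomArg S (S.ar o)} :
      AEqArg bs bs' → AEq (.op o bs) (.op o bs')
inductive AEqArg {S : Sig} : {ms : List ℕ} → NomArg S ms → NomArg S ms → Prop where
  | nil : AEqArg .nil .nil
  | cons {m : ℕ} {ms : List ℕ} {b b' : NomBind S m} {bs bs' : NomArg S ms} :
      AEqBind b b' → AEqArg bs bs' → AEqArg (.cons b bs) (.cons b' bs')
inductive AEqBind {S : Sig} : {m : ℕ} → NomBind S m → NomBind S m → Prop where
  | body {M M' : NomTrm S} : AEq M M' → AEqBind (.body M) (.body M')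
  | bind {m : ℕ} {x x' y : ℕ} {b b' : NomBind S m} :
      y ∉ NomBind.nsupp b → y ∉ NomBind.nsupp b' →
      AEqBind (NomBind.rename (rn1 x y) b) (NomBind.rename (rn1 x' y) b') →
      AEqBind (.bind x b) (.bind x' b')
end

/- Translation of nameful terms into well-scoped locally nameless terms;
bindings translate to iterated abstractions. -/
mutual
def NomTrm.transl : NomTrm S → Trm S 0
  | .atm x => .atm x
  | .op o bs => .op o (NomArg.transl bs)
def NomArg.transl : {ms : List ℕ} → NomArg S ms → Args S 0 ms
  | _, .nil => .nil
  | _, .cons b bs => .cons (NomBind.transl b) (NomArg.transl bs)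
def NomBind.transl : {m : ℕ} → NomBind S m → Trm S m
  | _, .body M => NomTrm.transl M
  | _, .bind x b => Trm.cls 0 x (NomBind.transl b)
end

/- A chosen atom not in a given finite set (one more than its maximum). -/
def newAtom (s : Finset ℕ) : ℕ := s.sup id + 1

/- Capture-avoiding substitution of nameful terms for atoms. -/
mutual
def NomTrm.nsubst (σ : ℕ → NomTrm S) : NomTrm S → NomTrm S
  | .atm x => σ x
  | .op o bs => .op o (NomArg.nsubst σ bs)
def NomArg.nsubst (σ : ℕ → NomTrm S) : {ms : List ℕ} → NomArg S ms → NomArg S ms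
  | _, .nil => .nil
  | _, .cons b bs => .cons (NomBind.nsubst σ b) (NomArg.nsubst σ bs)
def NomBind.nsubst (σ : ℕ → NomTrm S) : {m : ℕ} → NomBind S m → NomBind S m
  | _, .body M => .body (NomTrm.nsubst σ M)
  | _, .bind x b =>
      let y := newAtom ((NomBind.nsupp b).biUnion (fun z => NomTrm.nsupp (σ z)))
      .bind y (NomBind.nsubst (fun z => if x = z then .atm y else σ z) b)
end

theorem newAtom_notMem (s : Finset ℕ) : newAtom s ∉ s := by
  intro h
  have hle : newAtom s ≤ s.sup id := Finset.le_sup (f := id) h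
  exact Nat.not_succ_le_self _ hle

mutual
theorem Trm.weaken_self : {n : ℕ} → (h : n ≤ n) → (t : Trm S n) → Trm.weaken h t = t
  | _, _, .idx _ => by simp [Trm.weaken]
  | _, _, .atm _ => by simp only [Trm.weaken]
  | _, h, .op o as => by simp only [Trm.weaken, Args.weaken_self h as]
theorem Args.weaken_self : {n : ℕ} → {ms : List ℕ} → (h : n ≤ n) → (as : Args S n ms) →
    Args.weaken h as = as
  | _, _, _, .nil => by simp only [Args.weaken]
  | _, _, h, .cons t ts => by
      simp only [Args.weaken, Trm.weaken_self _ t, Args.weaken_self h ts]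
end

/- Closing a weakened term at an index above its original scope, along an atom
outside its support, is just weakening. -/
mutual
theorem Trm.cls_weaken_of_notMem_supp {y : ℕ} : {m n : ℕ} → (h : m ≤ n) →
    (i : Fin (n + 1)) → m ≤ (i : ℕ) → (t : Trm S m) → y ∉ t.supp →
    Trm.cls i y (Trm.weaken h t) = Trm.weaken (Nat.le_succ_of_le h) t
  | _, _, h, i, hi, .idx j, _ => by
      have hj : (Fin.castLE h j).castSucc < i := by
        simp only [Fin.lt_def, Fin.val_castSucc, Fin.val_castLE]
        omega
      simp only [Trm.weaken, Trm.cls, Fin.succAbove_of_castSucc_lt _ _ hj]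
      rfl
  | _, _, _, _, _, .atm x, hy => by
      have hyx : y ≠ x := by simpa [Trm.supp] using hy
      simp [Trm.weaken, Trm.cls, hyx]
  | _, _, h, i, hi, .op o as, hy => by
      simp only [Trm.supp] at hy
      simp only [Trm.weaken, Trm.cls, Args.cls_weaken_of_notMem_supp h i hi as hy]
theorem Args.cls_weaken_of_notMem_supp {y : ℕ} : {m n : ℕ} → {ms : List ℕ} →
    (h : m ≤ n) → (i : Fin (n + 1)) → m ≤ (i : ℕ) → (as : Args S m ms) → y ∉ as.supp →
    Args.cls i y (Args.weaken h as) = Args.weaken (Nat.le_succ_of_le h) as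
  | _, _, _, _, _, _, .nil, _ => by simp only [Args.weaken, Args.cls]
  | _, _, _, h, i, hi, .cons (m := k) t ts, hy => by
      simp only [Args.supp, Finset.mem_union, not_or] at hy
      simp only [Args.weaken, Args.cls]
      exact congrArg₂ Args.cons
        (Trm.cls_weaken_of_notMem_supp (Nat.add_le_add_left h k) (Fin.natAdd k i)
          (by rw [Fin.val_natAdd]; omega) t hy.1)
        (Args.cls_weaken_of_notMem_supp h i hi ts hy.2)
end

/- Substitution commutes with closing, up to a fresh choice of the closed atom. -/
mutual
theorem Trm.cls_subst_update (σ : ℕ → Trm S 0) (x y : ℕ) : {n : ℕ} → (i : Fin (n + 1)) →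
    (t : Trm S n) → (∀ z ∈ t.supp, y ∉ (σ z).supp) →
    Trm.cls i y (Trm.subst (fun z => if x = z then .atm y else σ z) t)
      = Trm.subst σ (Trm.cls i x t)
  | _, _, .idx _, _ => by simp only [Trm.subst, Trm.cls]
  | _, i, .atm z, hy => by
      by_cases hxz : x = z
      · simp [Trm.subst, Trm.cls, Trm.weaken, hxz]
      · simp only [Trm.subst, Trm.cls, hxz, if_false]
        exact Trm.cls_weaken_of_notMem_supp _ i (Nat.zero_le _) (σ z)
          (hy z (by simp [Trm.supp]))
  | _, i, .op o as, hy => by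
      simp only [Trm.supp] at hy
      simp only [Trm.subst, Trm.cls, Args.cls_subst_update σ x y i as hy]
theorem Args.cls_subst_update (σ : ℕ → Trm S 0) (x y : ℕ) : {n : ℕ} → {ms : List ℕ} →
    (i : Fin (n + 1)) → (as : Args S n ms) → (∀ z ∈ as.supp, y ∉ (σ z).supp) →
    Args.cls i y (Args.subst (fun z => if x = z then .atm y else σ z) as)
      = Args.subst σ (Args.cls i x as)
  | _, _, _, .nil, _ => by simp only [Args.subst, Args.cls]
  | n, _, i, .cons (m := k) t ts, hy => by
      simp only [Args.supp, Finset.mem_union] at hy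
      simp only [Args.subst, Args.cls]
      exact congrArg₂ Args.cons
        (Trm.cls_subst_update σ x y (n := k + n) (Fin.natAdd k i) t fun z hz => hy z (.inl hz))
        (Args.cls_subst_update σ x y i ts fun z hz => hy z (.inr hz))
end

mutual
theorem Trm.supp_cls_subset (x : ℕ) : {n : ℕ} → (i : Fin (n + 1)) → (t : Trm S n) →
    (Trm.cls i x t).supp ⊆ t.supp
  | _, _, .idx _ => by simp [Trm.cls, Trm.supp]
  | _, _, .atm z => by
      by_cases hxz : x = z <;> simp [Trm.cls, Trm.supp, hxz]
  | _, i, .op o as => by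
      simpa only [Trm.cls, Trm.supp] using Args.supp_cls_subset x i as
theorem Args.supp_cls_subset (x : ℕ) : {n : ℕ} → {ms : List ℕ} → (i : Fin (n + 1)) →
    (as : Args S n ms) → (Args.cls i x as).supp ⊆ as.supp
  | _, _, _, .nil => by simp [Args.cls, Args.supp]
  | n, _, i, .cons (m := k) t ts => by
      simp only [Args.cls, Args.supp]
      exact Finset.union_subset_union (Trm.supp_cls_subset x (n := k + n) (Fin.natAdd k i) t)
        (Args.supp_cls_subset x i ts)
end

mutual
theorem NomTrm.supp_transl_subset : (M : NomTrm S) → M.transl.supp ⊆ M.nsupp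
  | .atm _ => by simp [NomTrm.transl, Trm.supp, NomTrm.nsupp]
  | .op _ bs => by
      simpa only [NomTrm.transl, Trm.supp, NomTrm.nsupp] using NomArg.supp_transl_subset bs
theorem NomArg.supp_transl_subset : {ms : List ℕ} → (bs : NomArg S ms) →
    bs.transl.supp ⊆ bs.nsupp
  | _, .nil => by simp [NomArg.transl, Args.supp, NomArg.nsupp]
  | _, .cons b bs => by
      simp only [NomArg.transl, Args.supp, NomArg.nsupp]
      exact Finset.union_subset_union (NomBind.supp_transl_subset b)
        (NomArg.supp_transl_subset bs)
theorem NomBind.supp_transl_subset : {m : ℕ} → (b : NomBind S m) → b.transl.supp ⊆ b.nsupp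
  | _, .body M => by
      simpa only [NomBind.transl, NomBind.nsupp] using NomTrm.supp_transl_subset M
  | _, .bind x b => by
      simp only [NomBind.transl, NomBind.nsupp]
      exact ((Trm.supp_cls_subset x 0 b.transl).trans (NomBind.supp_transl_subset b)).trans
        (Finset.subset_insert _ _)
end

mutual
theorem NomTrm.transl_nsubst_eq (σ : ℕ → NomTrm S) : (M : NomTrm S) →
    (NomTrm.nsubst σ M).transl = Trm.subst (fun z => (σ z).transl) M.transl
  | .atm x => by
      simp only [NomTrm.nsubst, NomTrm.transl, Trm.subst, Trm.weaken_self]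
  | .op o bs => by
      simp only [NomTrm.nsubst, NomTrm.transl, Trm.subst, NomArg.transl_nsubst_eq σ bs]
theorem NomArg.transl_nsubst_eq (σ : ℕ → NomTrm S) : {ms : List ℕ} → (bs : NomArg S ms) →
    (NomArg.nsubst σ bs).transl = Args.subst (fun z => (σ z).transl) bs.transl
  | _, .nil => by simp only [NomArg.nsubst, NomArg.transl, Args.subst]
  | _, .cons b bs => by
      simp only [NomArg.nsubst, NomArg.transl, Args.subst]
      exact congrArg₂ Args.cons (NomBind.transl_nsubst_eq σ b) (NomArg.transl_nsubst_eq σ bs)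
theorem NomBind.transl_nsubst_eq (σ : ℕ → NomTrm S) : {m : ℕ} → (b : NomBind S m) →
    (NomBind.nsubst σ b).transl = Trm.subst (fun z => (σ z).transl) b.transl
  | _, .body M => by
      simp only [NomBind.nsubst, NomBind.transl, NomTrm.transl_nsubst_eq σ M]
  | _, .bind x b => by
      simp only [NomBind.nsubst, NomBind.transl, NomBind.transl_nsubst_eq _ b, apply_ite,
        NomTrm.transl]
      refine Trm.cls_subst_update (fun z => (σ z).transl) x _ 0 b.transl fun z hz hmem => ?_
      exact newAtom_notMem _ (Finset.mem_biUnion.2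
        ⟨z, NomBind.supp_transl_subset b hz, NomTrm.supp_transl_subset _ hmem⟩)
end

/-- The translation sends capture-avoiding substitution of nameful terms to
substitution of well-scoped locally nameless terms: ⟦σ * M⟧ = ⟦σ⟧ * ⟦M⟧;
in particular ⟦(x := P) * Q⟧ = (x := ⟦P⟧) * ⟦Q⟧. -/
theorem transl_nsubst (S : Sig) (σ : ℕ → NomTrm S) (M : NomTrm S) :
    (NomTrm.nsubst σ M).transl = Trm.subst (fun z => (σ z).transl) M.transl ∧
    ∀ (x : ℕ) (P Q : NomTrm S),
      (NomTrm.nsubst (fun z => if x = z then P else .atm z) Q).transl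
        = Trm.subst (single x P.transl) Q.transl := by
  refine ⟨NomTrm.transl_nsubst_eq σ M, fun x P Q => ?_⟩
  rw [NomTrm.transl_nsubst_eq]
  congr 1
  funext z
  simp only [single, apply_ite NomTrm.transl, NomTrm.transl]
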